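/- Let α > 0, let v : ℝ × ℝ → ℝ be a smooth solution of the Burgers equation v_t + v·v_x - α·v_xx = 0, and let u : ℝ × ℝ → ℝ be smooth with u(x,t) > 0 for all x, t, solving the linear equation u_t + v·u_x - α·u_xx = 0. Then φ(x,t) := -2α·u_x(x,t)/u(x,t) + v(x,t) is again a solution of the Burgers equation φ_t + φ·φ_x - α·φ_xx = 0 on ℝ × ℝ. -/

import Mathlib

open Real Filter MeasureTheory

/-- Partial derivative in the first (space) variable. -/
noncomputable def pdx (f : ℝ × ℝ → ℝ) (x t : ℝ) : ℝ := deriv (fun y => f (y, t)) x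

/-- Partial derivative in the second (time) variable. -/
noncomputable def pdt (f : ℝ × ℝ → ℝ) (x t : ℝ) : ℝ := deriv (fun s => f (x, s)) t

/-- Second partial derivative in the first (space) variable. -/
noncomputable def pdxx (f : ℝ × ℝ → ℝ) (x t : ℝ) : ℝ := deriv (fun y => pdx f y t) x

/-- A smooth function has the first partial derivative `pdx` along every horizontal line. -/
lemma hasDerivAt_pdx {f : ℝ × ℝ → ℝ} (hf : ContDiff ℝ (⊤ : ℕ∞) f) (x t : ℝ) :
    HasDerivAt (fun y => f (y, t)) (pdx f x t) x := by
  have h : Differentiable ℝ f := hf.differentiable (by simp)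
  have h' : Differentiable ℝ (fun y => f (y, t)) := by fun_prop
  exact (h' x).hasDerivAt

/-- A smooth function has the partial derivative `pdt` along every vertical line. -/
lemma hasDerivAt_pdt {f : ℝ × ℝ → ℝ} (hf : ContDiff ℝ (⊤ : ℕ∞) f) (x t : ℝ) :
    HasDerivAt (fun s => f (x, s)) (pdt f x t) t := by
  have h : Differentiable ℝ f := hf.differentiable (by simp)
  have h' : Differentiable ℝ (fun s => f (x, s)) := by fun_prop
  exact (h' t).hasDerivAt

lemma pdx_eq_fderiv {f : ℝ × ℝ → ℝ} {x t : ℝ} (hf : DifferentiableAt ℝ f (x, t)) :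
    pdx f x t = fderiv ℝ f (x, t) (1, 0) :=
  (hf.hasFDerivAt.comp_hasDerivAt x ((hasDerivAt_id x).prodMk (hasDerivAt_const x t))).deriv

lemma pdt_eq_fderiv {f : ℝ × ℝ → ℝ} {x t : ℝ} (hf : DifferentiableAt ℝ f (x, t)) :
    pdt f x t = fderiv ℝ f (x, t) (0, 1) :=
  (hf.hasFDerivAt.comp_hasDerivAt t ((hasDerivAt_const t x).prodMk (hasDerivAt_id t))).deriv

lemma pdx_eq_fderiv_apply {f : ℝ × ℝ → ℝ} (hf : Differentiable ℝ f) :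
    (fun p : ℝ × ℝ => pdx f p.1 p.2) = fun p => fderiv ℝ f p (1, 0) :=
  funext fun p => pdx_eq_fderiv (hf p)

lemma pdt_eq_fderiv_apply {f : ℝ × ℝ → ℝ} (hf : Differentiable ℝ f) :
    (fun p : ℝ × ℝ => pdt f p.1 p.2) = fun p => fderiv ℝ f p (0, 1) :=
  funext fun p => pdt_eq_fderiv (hf p)

lemma contDiff_pdx {f : ℝ × ℝ → ℝ} (hf : ContDiff ℝ (⊤ : ℕ∞) f) :
    ContDiff ℝ (⊤ : ℕ∞) (fun p : ℝ × ℝ => pdx f p.1 p.2) := by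
  rw [pdx_eq_fderiv_apply (hf.differentiable (by simp))]
  exact (hf.fderiv_right (m := (⊤ : ℕ∞)) (by simp)).clm_apply contDiff_const

/-- Symmetry of the mixed second partial derivatives of a smooth function. -/
lemma pdt_pdx_comm {f : ℝ × ℝ → ℝ} (hf : ContDiff ℝ (⊤ : ℕ∞) f) (x t : ℝ) :
    pdt (fun p => pdx f p.1 p.2) x t = pdx (fun p => pdt f p.1 p.2) x t := by
  have hd : Differentiable ℝ (fderiv ℝ f) :=
    (hf.fderiv_right (m := (⊤ : ℕ∞)) (by simp)).differentiable (by simp)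
  have happly (w : ℝ × ℝ) : HasFDerivAt (fun p => fderiv ℝ f p w)
      ((fderiv ℝ (fderiv ℝ f) (x, t)).flip w) (x, t) := by
    simpa using (hd (x, t)).hasFDerivAt.clm_apply (hasFDerivAt_const w (x, t))
  have hsymm : IsSymmSndFDerivAt ℝ f (x, t) :=
    hf.contDiffAt.isSymmSndFDerivAt (by
      rw [minSmoothness_of_isRCLikeNormedField]
      exact WithTop.coe_le_coe.2 (le_top : (2 : ℕ∞) ≤ ⊤))
  have hf' : Differentiable ℝ f := hf.differentiable (by simp)
  rw [pdx_eq_fderiv_apply hf', pdt_eq_fderiv_apply hf',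
    pdt_eq_fderiv (happly _).differentiableAt, pdx_eq_fderiv (happly _).differentiableAt,
    (happly _).fderiv, (happly _).fderiv]
  exact hsymm _ _

theorem burgers_new_solution_generation (α : ℝ) (hα : 0 < α)
    (v : ℝ × ℝ → ℝ) (hv : ContDiff ℝ (⊤ : ℕ∞) v)
    (hvburgers : ∀ x t : ℝ, pdt v x t + v (x, t) * pdx v x t - α * pdxx v x t = 0)
    (u : ℝ × ℝ → ℝ) (hu : ContDiff ℝ (⊤ : ℕ∞) u) (hupos : ∀ x t : ℝ, 0 < u (x, t))
    (hulin : ∀ x t : ℝ, pdt u x t + v (x, t) * pdx u x t - α * pdxx u x t = 0)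
    (φ : ℝ × ℝ → ℝ)
    (hφ : φ = fun p => -2 * α * pdx u p.1 p.2 / u p + v p) :
    ∀ x t : ℝ, pdt φ x t + φ (x, t) * pdx φ x t - α * pdxx φ x t = 0 := by
  subst hφ
  intro x t
  have hw := contDiff_pdx hu
  have hww := contDiff_pdx hw
  have hne (y s : ℝ) : u (y, s) ≠ 0 := (hupos y s).ne'
  have hux (y : ℝ) : HasDerivAt (fun z => u (z, t)) (pdx u y t) y := hasDerivAt_pdx hu y t
  have huxx (y : ℝ) : HasDerivAt (fun z => pdx u z t) (pdxx u y t) y := hasDerivAt_pdx hw y t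
  have huxxx : HasDerivAt (fun z => pdxx u z t) (deriv (fun z => pdxx u z t) x) x :=
    hasDerivAt_pdx hww x t
  have hvx (y : ℝ) : HasDerivAt (fun z => v (z, t)) (pdx v y t) y := hasDerivAt_pdx hv y t
  have hvxx : HasDerivAt (fun z => pdx v z t) (pdxx v x t) x :=
    hasDerivAt_pdx (contDiff_pdx hv) x t
  have hut : HasDerivAt (fun s => u (x, s)) (pdt u x t) t := hasDerivAt_pdt hu x t
  have huxt : HasDerivAt (fun s => pdx u x s) (pdt (fun p => pdx u p.1 p.2) x t) t :=
    hasDerivAt_pdt hw x t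
  have hvt : HasDerivAt (fun s => v (x, s)) (pdt v x t) t := hasDerivAt_pdt hv x t
  have hmixed : pdt (fun p => pdx u p.1 p.2) x t =
      α * deriv (fun z => pdxx u z t) x
        - (pdx v x t * pdx u x t + v (x, t) * pdxx u x t) := by
    rw [pdt_pdx_comm hu]
    have hpdt : (fun y => pdt u y t) = fun y => α * pdxx u y t - v (y, t) * pdx u y t := by
      funext y
      linarith [hulin y t]
    change deriv (fun y => pdt u y t) x = _
    rw [hpdt]
    exact ((huxxx.const_mul α).sub ((hvx x).mul (huxx x))).deriv
  set φ : ℝ × ℝ → ℝ := fun p => -2 * α * pdx u p.1 p.2 / u p + v p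
  have hφt : pdt φ x t = _ :=
    (((huxt.const_mul (-2 * α)).div hut (hne x t)).add hvt).deriv
  have hφx (y : ℝ) : pdx φ y t = _ :=
    ((((huxx y).const_mul (-2 * α)).div (hux y) (hne y t)).add (hvx y)).deriv
  have hφxx : pdxx φ x t = _ :=
    (congrArg (fun g => deriv g x) (funext hφx)).trans
      (((((huxxx.const_mul (-2 * α)).fun_mul (hux x)).fun_sub
        (((huxx x).const_mul (-2 * α)).fun_mul (huxx x))).fun_div ((hux x).fun_pow 2)
        (pow_ne_zero 2 (hne x t))).fun_add hvxx).deriv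
  rw [hφt, hφx, hφxx, hmixed]
  have hut_eq : pdt u x t = α * pdxx u x t - v (x, t) * pdx u x t := by linarith [hulin x t]
  have hvt_eq : pdt v x t = α * pdxx v x t - v (x, t) * pdx v x t := by linarith [hvburgers x t]
  rw [hut_eq, hvt_eq]
  have hne_xt := hne x t
  simp only [φ]
  field_simp
  ring
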